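/- Let m ∈ ℕ with m ≥ 1 and 0 < α < β ≤ 1, and let G be a Banach space. If g ∈ C^{m+1,β}_b(ℝ^d,G), then there exists a constant M such that for all f₁, f₂ ∈ C^{m,α}_b(ℝ^d,ℝ^d): ‖g∘(Id+f₁) − g∘(Id+f₂)‖_{m,α} ≤ M ‖g‖_{m+1,β} (1 + max(‖f₁‖_{m,α}, ‖f₂‖_{m,α}))^{m+1} ‖f₁−f₂‖_{m,α}. -/

import Mathlib

open Function Set Filter Topology MeasureTheory
open scoped ENNReal NNReal

noncomputable section

section Defs

variable {E F : Type*} [NormedAddCommGroup E] [NormedSpace ℝ E]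
  [NormedAddCommGroup F] [NormedSpace ℝ F]

/-- `‖f‖_n = max_{0 ≤ l ≤ n} sup_x ‖f⁽ˡ⁾(x)‖`, as an extended real. -/
def eCnb (n : ℕ) (f : E → F) : ℝ≥0∞ :=
  ⨆ (l : Fin (n + 1)) (x : E), (‖iteratedFDeriv ℝ (l : ℕ) f x‖₊ : ℝ≥0∞)

/-- The Hölder seminorm `[f]_{n,α}`, as an extended real. -/
def eHsemi (n : ℕ) (α : ℝ) (f : E → F) : ℝ≥0∞ :=
  ⨆ (x : E) (y : E) (_ : x ≠ y),
    (‖iteratedFDeriv ℝ n f x - iteratedFDeriv ℝ n f y‖₊ : ℝ≥0∞) / edist x y ^ α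

/-- The Hölder norm `‖f‖_{n,α} = max(‖f‖_n, [f]_{n,α})`, as an extended real. -/
def eHnorm (n : ℕ) (α : ℝ) (f : E → F) : ℝ≥0∞ := max (eCnb n f) (eHsemi n α f)

/-- The Hölder norm `‖f‖_{n,α}` as a real number (junk value `0` when infinite). -/
def hnorm (n : ℕ) (α : ℝ) (f : E → F) : ℝ := (eHnorm n α f).toReal

/-- Membership in the global Hölder space `C^{n,α}_b(E,F)`. -/
def MemCb (n : ℕ) (α : ℝ) (f : E → F) : Prop :=
  ContDiff ℝ (n : ℕ∞) f ∧ eHnorm n α f < ⊤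

/-- Membership in `C^{n,α}_0(E,F)`: moreover all derivatives up to order `n`
vanish at infinity. -/
def MemC0 (n : ℕ) (α : ℝ) (f : E → F) : Prop :=
  MemCb n α f ∧
    ∀ l ≤ n, Tendsto (fun x => ‖iteratedFDeriv ℝ l f x‖) (cocompact E) (𝓝 0)

end Defs

/-- `ℝ^d` -/
abbrev Euc (d : ℕ) : Type := EuclideanSpace ℝ (Fin d)

/-- Membership in the diffeomorphism group `D^{n,β}(ℝ^d)`:
`Φ - Id ∈ C^{n,β}_0` and `det dΦ(x) > 0` everywhere. -/
def MemD (d n : ℕ) (β : ℝ) (Φ : Euc d → Euc d) : Prop :=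
  MemC0 n β (fun x => Φ x - x) ∧
    ∀ x, 0 < LinearMap.det ((fderiv ℝ Φ x : Euc d →L[ℝ] Euc d) : Euc d →ₗ[ℝ] Euc d)

end

universe u

lemma nnnorm_div_edist_rpow_le_iff {E F : Type*} [NormedAddCommGroup E]
    [NormedAddCommGroup F] {α : ℝ} (hα : 0 < α) {C : ℝ≥0} {x y : E}
    (hxy : x ≠ y) (v : F) : (‖v‖₊ : ℝ≥0∞) / edist x y ^ α ≤ C ↔ ‖v‖ ≤ C * ‖x - y‖ ^ α := by
  have h0 : edist x y ^ α ≠ 0 := by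
    simp [ENNReal.rpow_eq_zero_iff, hxy, edist_ne_top]
  have h1 : edist x y ^ α ≠ ⊤ := ENNReal.rpow_ne_top_of_nonneg hα.le (edist_ne_top x y)
  rw [ENNReal.div_le_iff h0 h1, edist_nndist, ← ENNReal.coe_rpow_of_nonneg _ hα.le,
    ← ENNReal.coe_mul, ENNReal.coe_le_coe, ← NNReal.coe_le_coe]
  simp [dist_eq_norm]

lemma LipschitzWith.id_add {E : Type*} [NormedAddCommGroup E] {f : E → E} {R : ℝ≥0}
    (hf : LipschitzWith R f) (hR : 1 ≤ R) :
    LipschitzWith (2 * R) (fun x => x + f x) :=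
  (LipschitzWith.id.add hf).weaken (by rw [two_mul]; gcongr)

/-- A quantity bounded by `P` and by `Q t ^ β` is bounded by `(P + Q) t ^ α` when `α ≤ β`. -/
lemma le_add_mul_rpow {s t P Q α β : ℝ} (ht : 0 ≤ t) (hP : 0 ≤ P) (hQ : 0 ≤ Q) (hα : 0 < α)
    (hαβ : α ≤ β) (h₁ : s ≤ P) (h₂ : s ≤ Q * t ^ β) : s ≤ (P + Q) * t ^ α := by
  have htα : 0 ≤ t ^ α := Real.rpow_nonneg ht α
  rcases le_total t 1 with h | h
  · have : t ^ β ≤ t ^ α := Real.rpow_le_rpow_of_exponent_ge_of_imp ht h hαβ (by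
      intro _ hα0; linarith)
    nlinarith [mul_le_mul_of_nonneg_left this hQ, mul_nonneg hP htα]
  · have : 1 ≤ t ^ α := Real.one_le_rpow h hα.le
    nlinarith [mul_le_mul_of_nonneg_left this hP, mul_nonneg hQ htα]

/-- A bounded Lipschitz function is Hölder continuous. -/
lemma LipschitzWith.norm_sub_le_rpow {E F : Type*} [NormedAddCommGroup E]
    [NormedAddCommGroup F] {f : E → F} {L C : ℝ≥0} {α : ℝ} (hα : 0 < α) (hα1 : α ≤ 1)
    (hL : LipschitzWith L f) (hC : ∀ x, ‖f x‖ ≤ C) (x y : E) :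
    ‖f x - f y‖ ≤ (2 * C + L) * ‖x - y‖ ^ α := by
  refine le_add_mul_rpow (norm_nonneg _) (by positivity) L.2 hα hα1 ?_ ?_
  · linarith [_root_.norm_sub_le (f x) (f y), hC x, hC y]
  · simpa [dist_eq_norm] using hL.dist_le_mul x y

section HolderBound

variable {E F : Type*} [NormedAddCommGroup E] [NormedSpace ℝ E]
  [NormedAddCommGroup F] [NormedSpace ℝ F]

/-- `f` is of class `C^{n,α}_b` with `‖f‖_{n,α} ≤ C`. -/
def HolderBound (n : ℕ) (α : ℝ) (C : ℝ≥0) (f : E → F) : Prop :=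
  ContDiff ℝ (n : ℕ∞) f ∧ eHnorm n α f ≤ C

lemma eHsemi_le_iff {n : ℕ} {α : ℝ} (hα : 0 < α) {C : ℝ≥0} {f : E → F} :
    eHsemi n α f ≤ C ↔
      ∀ x y, ‖iteratedFDeriv ℝ n f x - iteratedFDeriv ℝ n f y‖ ≤ C * ‖x - y‖ ^ α := by
  simp only [eHsemi, iSup_le_iff]
  refine forall_congr' fun x => forall_congr' fun y => ?_
  by_cases hxy : x = y
  · subst hxy
    simp [hα.ne']
  · simp only [ne_eq, hxy, not_false_eq_true, forall_true_left]
    exact nnnorm_div_edist_rpow_le_iff hα hxy _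

lemma eCnb_le_iff {n : ℕ} {C : ℝ≥0} {f : E → F} :
    eCnb n f ≤ C ↔ ∀ (l : Fin (n + 1)) (x : E), ‖iteratedFDeriv ℝ (l : ℕ) f x‖ ≤ C := by
  simp only [eCnb, iSup_le_iff, ENNReal.coe_le_coe, ← NNReal.coe_le_coe, coe_nnnorm]

lemma norm_iteratedFDeriv_succ_sub (n : ℕ) (f : E → F) (x y : E) :
    ‖iteratedFDeriv ℝ (n + 1) f x - iteratedFDeriv ℝ (n + 1) f y‖ =
      ‖iteratedFDeriv ℝ n (fderiv ℝ f) x - iteratedFDeriv ℝ n (fderiv ℝ f) y‖ := by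
  rw [iteratedFDeriv_succ_eq_comp_right, Function.comp_apply,
    iteratedFDeriv_succ_eq_comp_right, Function.comp_apply, ← dist_eq_norm, ← dist_eq_norm]
  exact LinearIsometryEquiv.dist_map _ _ _

lemma norm_iteratedFDeriv_zero_sub (f : E → F) (x y : E) :
    ‖iteratedFDeriv ℝ 0 f x - iteratedFDeriv ℝ 0 f y‖ = ‖f x - f y‖ := by
  simp only [iteratedFDeriv_zero_eq_comp, Function.comp_apply]
  rw [← map_sub, LinearIsometryEquiv.norm_map]

lemma holderBound_zero_iff {α : ℝ} (hα : 0 < α) {C : ℝ≥0} {f : E → F} :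
    HolderBound 0 α C f ↔ Continuous f ∧ (∀ x, ‖f x‖ ≤ C) ∧
      ∀ x y, ‖f x - f y‖ ≤ C * ‖x - y‖ ^ α := by
  simp only [HolderBound, eHnorm, max_le_iff, eCnb_le_iff, eHsemi_le_iff hα,
    norm_iteratedFDeriv_zero_sub]
  simp [contDiff_zero]

lemma holderBound_succ_iff {n : ℕ} {α : ℝ} (hα : 0 < α) {C : ℝ≥0} {f : E → F} :
    HolderBound (n + 1) α C f ↔ Differentiable ℝ f ∧ (∀ x, ‖f x‖ ≤ C) ∧
      HolderBound n α C (fderiv ℝ f) := by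
  have hc : ContDiff ℝ ((n + 1 : ℕ) : ℕ∞) f ↔
      Differentiable ℝ f ∧ ContDiff ℝ (n : ℕ∞) (fderiv ℝ f) := by
    have := contDiff_succ_iff_fderiv (𝕜 := ℝ) (f := f) (n := (n : ℕ∞))
    simpa using this
  simp only [HolderBound, eHnorm, max_le_iff, eCnb_le_iff, eHsemi_le_iff hα,
    norm_iteratedFDeriv_succ_sub, hc]
  rw [Fin.forall_fin_succ]
  have h0 (x : E) : ‖iteratedFDeriv ℝ ((0 : Fin (n + 1 + 1)) : ℕ) f x‖ = ‖f x‖ :=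
    norm_iteratedFDeriv_zero
  simp only [h0, Fin.val_succ, ← norm_iteratedFDeriv_fderiv]
  tauto

lemma HolderBound.mono {n : ℕ} {α : ℝ} {C D : ℝ≥0} {f : E → F}
    (h : HolderBound n α C f) (hCD : C ≤ D) : HolderBound n α D f :=
  ⟨h.1, h.2.trans (by exact_mod_cast hCD)⟩

lemma HolderBound.hnorm_le {n : ℕ} {α : ℝ} {C : ℝ≥0} {f : E → F}
    (h : HolderBound n α C f) : hnorm n α f ≤ C :=
  ENNReal.toReal_le_coe_of_le_coe h.2

lemma MemCb.holderBound {n : ℕ} {α : ℝ} {f : E → F} (h : MemCb n α f) :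
    HolderBound n α (eHnorm n α f).toNNReal f :=
  ⟨h.1, (ENNReal.coe_toNNReal h.2.ne).ge⟩

lemma HolderBound.norm_le {n : ℕ} {α : ℝ} (hα : 0 < α) {C : ℝ≥0} {f : E → F}
    (h : HolderBound n α C f) (x : E) : ‖f x‖ ≤ C := by
  cases n with
  | zero => exact ((holderBound_zero_iff hα).1 h).2.1 x
  | succ n => exact ((holderBound_succ_iff hα).1 h).2.1 x

lemma HolderBound.lipschitzWith {n : ℕ} {α : ℝ} (hα : 0 < α) {C : ℝ≥0} {f : E → F}
    (h : HolderBound (n + 1) α C f) : LipschitzWith C f := by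
  obtain ⟨hd, -, h'⟩ := (holderBound_succ_iff hα).1 h
  exact lipschitzWith_of_nnnorm_fderiv_le hd fun x => h'.norm_le hα x

end HolderBound

section Calculus

variable {E : Type u} [NormedAddCommGroup E] [NormedSpace ℝ E] {α : ℝ}

lemma HolderBound.of_succ (hα : 0 < α) (hα1 : α ≤ 1) (n : ℕ) :
    ∀ {F : Type u} [NormedAddCommGroup F] [NormedSpace ℝ F] {C : ℝ≥0} {f : E → F},
      HolderBound (n + 1) α C f → HolderBound n α (3 * C) f := by
  have hC3 (C : ℝ≥0) : C ≤ 3 * C := le_mul_of_one_le_left' (by norm_num)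
  induction n with
  | zero =>
    intro F _ _ C f h
    have hL := h.lipschitzWith hα
    refine (holderBound_zero_iff hα).2 ⟨hL.continuous, fun x => ?_, fun x y => ?_⟩
    · exact (h.norm_le hα x).trans (by exact_mod_cast hC3 C)
    · refine (hL.norm_sub_le_rpow hα hα1 (h.norm_le hα) x y).trans_eq ?_
      push_cast
      ring
  | succ n ih =>
    intro F _ _ C f h
    obtain ⟨hd, hb, h'⟩ := (holderBound_succ_iff hα).1 h
    exact (holderBound_succ_iff hα).2
      ⟨hd, fun x => (hb x).trans (by exact_mod_cast hC3 C), ih h'⟩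

lemma HolderBound.const (hα : 0 < α) (n : ℕ) :
    ∀ {F : Type u} [NormedAddCommGroup F] [NormedSpace ℝ F] {C : ℝ≥0} {c : F},
      ‖c‖ ≤ C → HolderBound n α C (fun _ : E => c) := by
  induction n with
  | zero =>
    intro F _ _ C c h
    exact (holderBound_zero_iff hα).2
      ⟨continuous_const, fun _ => h, fun x y => by simpa using by positivity⟩
  | succ n ih =>
    intro F _ _ C c h
    refine (holderBound_succ_iff hα).2 ⟨differentiable_const c, fun _ => h, ?_⟩
    rw [show fderiv ℝ (fun _ : E => c) = fun _ => 0 by ext; simp]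
    exact ih (by simp)

lemma HolderBound.add (hα : 0 < α) (n : ℕ) :
    ∀ {F : Type u} [NormedAddCommGroup F] [NormedSpace ℝ F] {C D : ℝ≥0} {f g : E → F},
      HolderBound n α C f → HolderBound n α D g →
        HolderBound n α (C + D) (fun x => f x + g x) := by
  induction n with
  | zero =>
    intro F _ _ C D f g hf hg
    obtain ⟨cf, bf, sf⟩ := (holderBound_zero_iff hα).1 hf
    obtain ⟨cg, bg, sg⟩ := (holderBound_zero_iff hα).1 hg
    refine (holderBound_zero_iff hα).2
      ⟨cf.add cg, fun x => norm_add_le_of_le (bf x) (bg x), fun x y => ?_⟩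
    rw [add_sub_add_comm]
    refine (norm_add_le_of_le (sf x y) (sg x y)).trans_eq ?_
    push_cast
    ring
  | succ n ih =>
    intro F _ _ C D f g hf hg
    obtain ⟨df, bf, sf⟩ := (holderBound_succ_iff hα).1 hf
    obtain ⟨dg, bg, sg⟩ := (holderBound_succ_iff hα).1 hg
    refine (holderBound_succ_iff hα).2
      ⟨df.add dg, fun x => norm_add_le_of_le (bf x) (bg x), ?_⟩
    rw [show fderiv ℝ (fun x => f x + g x) = fun x => fderiv ℝ f x + fderiv ℝ g x from
      funext fun x => fderiv_fun_add (df x) (dg x)]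
    exact ih sf sg

lemma HolderBound.neg (hα : 0 < α) (n : ℕ) :
    ∀ {F : Type u} [NormedAddCommGroup F] [NormedSpace ℝ F] {C : ℝ≥0} {f : E → F},
      HolderBound n α C f → HolderBound n α C (fun x => -f x) := by
  induction n with
  | zero =>
    intro F _ _ C f hf
    obtain ⟨cf, bf, sf⟩ := (holderBound_zero_iff hα).1 hf
    refine (holderBound_zero_iff hα).2
      ⟨cf.neg, fun x => by simpa using bf x, fun x y => ?_⟩
    rw [neg_sub_neg, norm_sub_rev]
    exact sf x y
  | succ n ih =>
    intro F _ _ C f hf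
    obtain ⟨df, bf, sf⟩ := (holderBound_succ_iff hα).1 hf
    refine (holderBound_succ_iff hα).2 ⟨df.neg, fun x => by simpa using bf x, ?_⟩
    rw [show fderiv ℝ (fun x => -f x) = fun x => -fderiv ℝ f x from
      funext fun x => fderiv_fun_neg]
    exact ih sf

lemma HolderBound.sub (hα : 0 < α) {n : ℕ} {F : Type u} [NormedAddCommGroup F]
    [NormedSpace ℝ F] {C D : ℝ≥0} {f g : E → F} (hf : HolderBound n α C f)
    (hg : HolderBound n α D g) : HolderBound n α (C + D) (f - g) := by
  have h := HolderBound.add hα n hf (HolderBound.neg hα n hg)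
  simp only [← sub_eq_add_neg] at h
  exact h

/-- Products of `C^{n,α}_b` maps under a bilinear map. -/
lemma HolderBound.exists_bilinear (hα : 0 < α) (hα1 : α ≤ 1) (n : ℕ) :
    ∃ K : ℝ≥0, ∀ (F₁ F₂ F₃ : Type u) [NormedAddCommGroup F₁] [NormedSpace ℝ F₁]
      [NormedAddCommGroup F₂] [NormedSpace ℝ F₂] [NormedAddCommGroup F₃] [NormedSpace ℝ F₃]
      (B : F₁ →L[ℝ] F₂ →L[ℝ] F₃) (C D : ℝ≥0) (f : E → F₁) (g : E → F₂), ‖B‖ ≤ 1 →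
      HolderBound n α C f → HolderBound n α D g →
        HolderBound n α (K * (C * D)) (fun x => B (f x) (g x)) := by
  have key {F₁ F₂ F₃ : Type u} [NormedAddCommGroup F₁] [NormedSpace ℝ F₁]
      [NormedAddCommGroup F₂] [NormedSpace ℝ F₂] [NormedAddCommGroup F₃] [NormedSpace ℝ F₃]
      {B : F₁ →L[ℝ] F₂ →L[ℝ] F₃} (hB : ‖B‖ ≤ 1) {v : F₁} {w : F₂} {a b : ℝ}
      (hv : ‖v‖ ≤ a) (hw : ‖w‖ ≤ b) : ‖B v w‖ ≤ a * b := by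
    have := B.le_of_opNorm₂_le_of_le hB hv hw
    simpa using this
  induction n with
  | zero =>
    refine ⟨2, fun F₁ F₂ F₃ _ _ _ _ _ _ B C D f g hB hf hg => ?_⟩
    obtain ⟨cf, bf, sf⟩ := (holderBound_zero_iff hα).1 hf
    obtain ⟨cg, bg, sg⟩ := (holderBound_zero_iff hα).1 hg
    have hCD : (0 : ℝ) ≤ C * D := by positivity
    refine (holderBound_zero_iff hα).2
      ⟨(B.continuous.comp cf).clm_apply cg, fun x => ?_, fun x y => ?_⟩
    · refine (key hB (bf x) (bg x)).trans ?_
      push_cast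
      linarith
    · rw [show B (f x) (g x) - B (f y) (g y) = B (f x - f y) (g x) + B (f y) (g x - g y) by
        simp]
      refine (norm_add_le_of_le (key hB (sf x y) (bg x)) (key hB (bf y) (sg x y))).trans_eq ?_
      push_cast
      ring
  | succ n ih =>
    obtain ⟨K, hK⟩ := ih
    refine ⟨1 + 6 * K, fun F₁ F₂ F₃ _ _ _ _ _ _ B C D f g hB hf hg => ?_⟩
    obtain ⟨df, bf, sf⟩ := (holderBound_succ_iff hα).1 hf
    obtain ⟨dg, bg, sg⟩ := (holderBound_succ_iff hα).1 hg
    have hf' := HolderBound.of_succ hα hα1 n hf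
    have hg' := HolderBound.of_succ hα hα1 n hg
    refine (holderBound_succ_iff hα).2 ⟨fun x => ?_, fun x => ?_, ?_⟩
    · exact (B.hasFDerivAt_of_bilinear (df x).hasFDerivAt (dg x).hasFDerivAt).differentiableAt
    · refine (key hB (bf x) (bg x)).trans ?_
      norm_cast
      exact le_mul_of_one_le_left' (by simp)
    · rw [show fderiv ℝ (fun x => B (f x) (g x)) = fun x =>
          B.precompR E (f x) (fderiv ℝ g x) + B.precompL E (fderiv ℝ f x) (g x) from
        funext fun x => B.fderiv_of_bilinear (df x) (dg x)]
      refine (HolderBound.add hα n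
        (hK _ _ _ (B.precompR E) _ _ _ _ ((B.norm_precompR_le E).trans hB) hf' sg)
        (hK _ _ _ (B.precompL E) _ _ _ _ ((B.norm_precompL_le E).trans hB) sf hg')).mono ?_
      calc K * (3 * C * D) + K * (C * (3 * D)) = 6 * K * (C * D) := by ring
        _ ≤ (1 + 6 * K) * (C * D) := by gcongr; simp

lemma hasFDerivAt_comp_id_add {F : Type*} [NormedAddCommGroup F] [NormedSpace ℝ F]
    {g : E → F} {f : E → E} (hg : Differentiable ℝ g) (hf : Differentiable ℝ f) (x : E) :
    HasFDerivAt (fun x => g (x + f x))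
      ((fderiv ℝ g (x + f x)).comp (ContinuousLinearMap.id ℝ E + fderiv ℝ f x)) x :=
  (hg _).hasFDerivAt.comp x ((hasFDerivAt_id x).add (hf x).hasFDerivAt)

lemma HolderBound.id_add_fderiv (hα : 0 < α) {n : ℕ} {f : E → E} {R : ℝ≥0} (hR : 1 ≤ R)
    (hf : HolderBound n α R (fderiv ℝ f)) :
    HolderBound n α (2 * R) (fun x => ContinuousLinearMap.id ℝ E + fderiv ℝ f x) :=
  (HolderBound.add hα n (HolderBound.const hα n
    (ContinuousLinearMap.norm_id_le.trans (by exact_mod_cast hR))) hf).mono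
    (by rw [two_mul])

/-- Composition with `Id + f` preserves Hölder classes, at the cost of one derivative. -/
lemma HolderBound.exists_comp_id_add {β : ℝ} (hα : 0 < α) (hα1 : α ≤ 1) (hβ : 0 < β) (n : ℕ) :
    ∃ K : ℝ≥0, ∀ (F : Type u) [NormedAddCommGroup F] [NormedSpace ℝ F] (A R : ℝ≥0)
      (g : E → F) (f : E → E), 1 ≤ R → HolderBound (n + 1) β A g → HolderBound n α R f →
      LipschitzWith R f → HolderBound n α (K * (A * R ^ (n + 1))) (fun x => g (x + f x)) := by
  induction n with
  | zero =>
    refine ⟨4, fun F _ _ A R g f hR hg hf hL => ?_⟩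
    have hgf := (hg.lipschitzWith hβ).comp (hL.id_add hR)
    have hR' : (1 : ℝ) ≤ R := hR
    have hAR : (A : ℝ) ≤ A * R := le_mul_of_one_le_right A.2 hR'
    refine (holderBound_zero_iff hα).2 ⟨hgf.continuous, fun x => ?_, fun x y => ?_⟩
    · refine (hg.norm_le hβ _).trans ?_
      push_cast
      nlinarith [A.2]
    · refine (hgf.norm_sub_le_rpow hα hα1 (fun _ => hg.norm_le hβ _) x y).trans ?_
      gcongr
      push_cast
      linarith
  | succ n ih =>
    obtain ⟨K, hK⟩ := ih
    obtain ⟨P, hP⟩ := HolderBound.exists_bilinear (E := E) hα hα1 n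
    refine ⟨1 + P * K * 3 ^ (n + 1) * 2, fun F _ _ A R g f hR hg hf hL => ?_⟩
    obtain ⟨dg, bg, sg⟩ := (holderBound_succ_iff hβ).1 hg
    obtain ⟨df, -, sf⟩ := (holderBound_succ_iff hα).1 hf
    have hR3 : R ≤ 3 * R := le_mul_of_one_le_left' (by norm_num)
    have hd := hasFDerivAt_comp_id_add dg df
    refine (holderBound_succ_iff hα).2 ⟨fun x => (hd x).differentiableAt, fun x => ?_, ?_⟩
    · refine (bg _).trans ?_
      have h₁ : A ≤ A * R ^ (n + 1 + 1) := le_mul_of_one_le_right' (one_le_pow₀ hR)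
      exact_mod_cast h₁.trans (le_mul_of_one_le_left' (by simp))
    · rw [show fderiv ℝ (fun x => g (x + f x)) = _ from funext fun x => (hd x).fderiv]
      refine (hP _ _ _ (ContinuousLinearMap.compL ℝ E E F) _ _ _ _
        (ContinuousLinearMap.norm_compL_le _ _ _ _)
        (hK _ A (3 * R) _ f (hR.trans hR3) sg (HolderBound.of_succ hα hα1 n hf)
          (hL.weaken hR3)) (HolderBound.id_add_fderiv hα hR sf)).mono ?_
      calc P * (K * (A * (3 * R) ^ (n + 1)) * (2 * R))
          = P * K * 3 ^ (n + 1) * 2 * (A * R ^ (n + 1 + 1)) := by ring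
        _ ≤ _ := by gcongr; simp

/-- The case `m = 0` of the Lipschitz estimate for left translations. -/
lemma HolderBound.comp_id_add_sub_zero {β : ℝ} (hα : 0 < α) (hαβ : α ≤ β) (hα1 : α ≤ 1)
    {F : Type u} [NormedAddCommGroup F] [NormedSpace ℝ F] {A R H : ℝ≥0} {g : E → F}
    {f₁ f₂ : E → E} (hR : 1 ≤ R) (hg : HolderBound 1 β A g) (h₁ : LipschitzWith R f₁)
    (h₂ : LipschitzWith R f₂) (hH : HolderBound 0 α H (f₁ - f₂)) :
    HolderBound 0 α (7 * (A * R * H)) (fun x => g (x + f₁ x) - g (x + f₂ x)) := by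
  have hβ := hα.trans_le hαβ
  obtain ⟨dg, -, sg⟩ := (holderBound_succ_iff hβ).1 hg
  obtain ⟨-, bg', sg'⟩ := (holderBound_zero_iff hβ).1 sg
  obtain ⟨-, bh, sh⟩ := (holderBound_zero_iff hα).1 hH
  have hgL := hg.lipschitzWith hβ
  have hL₁ := h₁.id_add hR
  have hL₂ := h₂.id_add hR
  have hR' : (1 : ℝ) ≤ R := hR
  refine (holderBound_zero_iff hα).2
    ⟨(hgL.comp hL₁).continuous.sub (hgL.comp hL₂).continuous, fun x => ?_, fun x y => ?_⟩
  · have h := hgL.dist_le_mul (x + f₁ x) (x + f₂ x)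
    rw [dist_eq_norm, dist_eq_norm, add_sub_add_left_eq_sub] at h
    have hAH : (A : ℝ) * H ≤ A * H * R := le_mul_of_one_le_right (by positivity) hR'
    have hAH' : (0 : ℝ) ≤ A * H := by positivity
    have hb : A * ‖f₁ x - f₂ x‖ ≤ (A : ℝ) * H := by gcongr; exact bh x
    push_cast
    linarith
  · set h := f₁ - f₂ with hh
    set p : E → ℝ → E := fun x t => x + f₂ x + t • h x with hp
    have hp1 (x : E) : p x 1 = x + f₁ x := by simp [hp, hh]
    have hp0 (x : E) : p x 0 = x + f₂ x := by simp [hp]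
    have hpd (x : E) (t : ℝ) : HasDerivAt (p x) (h x) t := by
      simpa only [id, one_smul] using
        ((hasDerivAt_id t).smul_const (h x)).const_add (x + f₂ x)
    have hgd (x : E) (t : ℝ) :
        HasDerivAt (fun t => g (p x t)) (fderiv ℝ g (p x t) (h x)) t :=
      (dg (p x t)).hasFDerivAt.comp_hasDerivAt t (hpd x t)
    have hDg (u v : E) :
        ‖fderiv ℝ g u - fderiv ℝ g v‖ ≤ (2 * A + A : ℝ) * ‖u - v‖ ^ α := by
      refine le_add_mul_rpow (norm_nonneg _) (by positivity) A.2 hα hαβ ?_ (sg' u v)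
      linarith [norm_sub_le (fderiv ℝ g u) (fderiv ℝ g v), bg' u, bg' v]
    have hpp (t : ℝ) (ht : t ∈ Ico (0 : ℝ) 1) : ‖p x t - p y t‖ ≤ 2 * R * ‖x - y‖ := by
      have e : p x t - p y t = (1 - t) • ((x + f₂ x) - (y + f₂ y)) +
          t • ((x + f₁ x) - (y + f₁ y)) := by
        simp only [hp, hh, Pi.sub_apply]
        module
      have i₁ := hL₁.dist_le_mul x y
      have i₂ := hL₂.dist_le_mul x y
      simp only [dist_eq_norm, NNReal.coe_mul, NNReal.coe_ofNat] at i₁ i₂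
      rw [e]
      refine (norm_add_le _ _).trans ?_
      rw [norm_smul, norm_smul, Real.norm_of_nonneg ht.1,
        Real.norm_of_nonneg (sub_nonneg.2 ht.2.le)]
      nlinarith [mul_le_mul_of_nonneg_left i₁ ht.1,
        mul_le_mul_of_nonneg_left i₂ (sub_nonneg.2 ht.2.le)]
    have hppα (t : ℝ) (ht : t ∈ Ico (0 : ℝ) 1) :
        ‖p x t - p y t‖ ^ α ≤ 2 * R * ‖x - y‖ ^ α := by
      refine (Real.rpow_le_rpow (norm_nonneg _) (hpp t ht) hα.le).trans ?_
      rw [Real.mul_rpow (by positivity) (norm_nonneg _)]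
      gcongr
      exact Real.rpow_le_self_of_one_le (by linarith) hα1
    have hmv := norm_image_sub_le_of_norm_deriv_le_segment_01'
      (f := fun t => g (p x t) - g (p y t)) (C := 7 * (A * R * H) * ‖x - y‖ ^ α)
      (fun t _ => ((hgd x t).sub (hgd y t)).hasDerivWithinAt) (fun t ht => by
        rw [show fderiv ℝ g (p x t) (h x) - fderiv ℝ g (p y t) (h y) =
          (fderiv ℝ g (p x t) - fderiv ℝ g (p y t)) (h x) + fderiv ℝ g (p y t) (h x - h y) by
            simp]
        refine (norm_add_le_of_le
          (ContinuousLinearMap.le_of_opNorm_le_of_le _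
            ((hDg _ _).trans (mul_le_mul_of_nonneg_left (hppα t ht) (by positivity))) (bh x))
          (ContinuousLinearMap.le_of_opNorm_le_of_le _ (bg' _) (sh x y))).trans ?_
        have : 0 ≤ A * H * ‖x - y‖ ^ α := by positivity
        nlinarith [mul_le_mul_of_nonneg_left hR' this])
    simp only [hp1, hp0] at hmv
    rw [sub_sub_sub_comm]
    push_cast
    exact hmv

/-- Local Lipschitz estimate for `f ↦ g ∘ (Id + f)` in Hölder norms. -/
lemma HolderBound.exists_comp_id_add_sub {β : ℝ} (hα : 0 < α) (hαβ : α ≤ β) (hα1 : α ≤ 1)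
    (n : ℕ) :
    ∃ K : ℝ≥0, ∀ (F : Type u) [NormedAddCommGroup F] [NormedSpace ℝ F] (A R H : ℝ≥0)
      (g : E → F) (f₁ f₂ : E → E), 1 ≤ R → HolderBound (n + 1) β A g →
      HolderBound n α R f₁ → HolderBound n α R f₂ → LipschitzWith R f₁ → LipschitzWith R f₂ →
      HolderBound n α H (f₁ - f₂) →
        HolderBound n α (K * (A * R ^ (n + 1) * H))
          (fun x => g (x + f₁ x) - g (x + f₂ x)) := by
  have hβ := hα.trans_le hαβ
  induction n with
  | zero =>
    refine ⟨7, fun F _ _ A R H g f₁ f₂ hR hg _ _ h₁ h₂ hH => ?_⟩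
    simpa using HolderBound.comp_id_add_sub_zero hα hαβ hα1 hR hg h₁ h₂ hH
  | succ n ih =>
    obtain ⟨K, hK⟩ := ih
    obtain ⟨P, hP⟩ := HolderBound.exists_bilinear (E := E) hα hα1 n
    obtain ⟨Q, hQ⟩ := HolderBound.exists_comp_id_add (E := E) hα hα1 hβ n
    refine ⟨1 + P * K * 3 ^ (n + 1) * 6 + P * Q * 3 ^ (n + 1),
      fun F _ _ A R H g f₁ f₂ hR hg hf₁ hf₂ hL₁ hL₂ hH => ?_⟩
    obtain ⟨dg, -, sg⟩ := (holderBound_succ_iff hβ).1 hg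
    obtain ⟨df₁, -, sf₁⟩ := (holderBound_succ_iff hα).1 hf₁
    obtain ⟨df₂, -, -⟩ := (holderBound_succ_iff hα).1 hf₂
    obtain ⟨-, bh, sh⟩ := (holderBound_succ_iff hα).1 hH
    have hR3 : R ≤ 3 * R := le_mul_of_one_le_left' (by norm_num)
    have hd₁ := hasFDerivAt_comp_id_add dg df₁
    have hd₂ := hasFDerivAt_comp_id_add dg df₂
    have hf₁' := HolderBound.of_succ hα hα1 n hf₁
    have hf₂' := HolderBound.of_succ hα hα1 n hf₂
    refine (holderBound_succ_iff hα).2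
      ⟨fun x => ((hd₁ x).sub (hd₂ x)).differentiableAt, fun x => ?_, ?_⟩
    · have h := (hg.lipschitzWith hβ).dist_le_mul (x + f₁ x) (x + f₂ x)
      rw [dist_eq_norm, dist_eq_norm, add_sub_add_left_eq_sub] at h
      refine h.trans ((mul_le_mul_of_nonneg_left (bh x) A.2).trans ?_)
      have i₁ : A * H ≤ A * R ^ (n + 1 + 1) * H := by
        gcongr
        exact le_mul_of_one_le_right' (one_le_pow₀ hR)
      exact_mod_cast i₁.trans (le_mul_of_one_le_left' (by simp [add_assoc]))
    · have e : fderiv ℝ (fun x => g (x + f₁ x) - g (x + f₂ x)) = fun x =>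
          ContinuousLinearMap.compL ℝ E E F
            (fderiv ℝ g (x + f₁ x) - fderiv ℝ g (x + f₂ x))
            (ContinuousLinearMap.id ℝ E + fderiv ℝ f₁ x) +
          ContinuousLinearMap.compL ℝ E E F (fderiv ℝ g (x + f₂ x))
            (fderiv ℝ (f₁ - f₂) x) := by
        funext x
        rw [fderiv_fun_sub (hd₁ x).differentiableAt (hd₂ x).differentiableAt, (hd₁ x).fderiv,
          (hd₂ x).fderiv, fderiv_sub (df₁ x) (df₂ x)]
        ext v
        simp only [sub_apply, add_apply, map_sub, map_add, ContinuousLinearMap.compL_apply,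
          ContinuousLinearMap.comp_apply, ContinuousLinearMap.id_apply]
        abel
      rw [e]
      have hcomp := ContinuousLinearMap.norm_compL_le ℝ E E F
      refine (HolderBound.add hα n
        (hP _ _ _ _ _ _ _ _ hcomp
          (hK _ A (3 * R) (3 * H) _ f₁ f₂ (hR.trans hR3) sg hf₁' hf₂' (hL₁.weaken hR3)
            (hL₂.weaken hR3) (HolderBound.of_succ hα hα1 n hH))
          (HolderBound.id_add_fderiv hα hR sf₁))
        (hP _ _ _ _ _ _ _ _ hcomp
          (hQ _ A (3 * R) _ f₂ (hR.trans hR3) sg hf₂' (hL₂.weaken hR3)) sh)).mono ?_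
      calc P * (K * (A * (3 * R) ^ (n + 1) * (3 * H)) * (2 * R)) +
            P * (Q * (A * (3 * R) ^ (n + 1)) * H)
          = P * K * 3 ^ (n + 1) * 6 * (A * R ^ (n + 1 + 1) * H) +
            P * Q * 3 ^ (n + 1) * (A * R ^ (n + 1) * H) := by ring
        _ ≤ P * K * 3 ^ (n + 1) * 6 * (A * R ^ (n + 1 + 1) * H) +
            P * Q * 3 ^ (n + 1) * (A * R ^ (n + 1 + 1) * H) := by
          gcongr 2
          exact mul_le_mul_left (mul_le_mul_right (pow_le_pow_right₀ hR (Nat.le_succ _)) _) _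
        _ = (P * K * 3 ^ (n + 1) * 6 + P * Q * 3 ^ (n + 1)) *
            (A * R ^ (n + 1 + 1) * H) := by ring
        _ ≤ _ := by
          rw [add_assoc 1]
          exact mul_le_mul_left le_add_self _

end Calculus

/-- Lipschitz continuity of left translations:
for `g ∈ C^{m+1,β}_b(ℝ^d,G)` and `0 < α < β ≤ 1` there is a constant `M` with
`‖g∘(Id+f₁) − g∘(Id+f₂)‖_{m,α}
  ≤ M ‖g‖_{m+1,β} (1 + max(‖f₁‖_{m,α},‖f₂‖_{m,α}))^{m+1} ‖f₁−f₂‖_{m,α}`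
for all `f₁, f₂ ∈ C^{m,α}_b(ℝ^d,ℝ^d)`. -/
theorem stmt4 (d m : ℕ) (hm : 1 ≤ m) (α β : ℝ) (hα : 0 < α) (hαβ : α < β) (hβ : β ≤ 1)
    (G : Type) [NormedAddCommGroup G] [NormedSpace ℝ G] [CompleteSpace G]
    (g : Euc d → G) (hg : MemCb (m + 1) β g) :
    ∃ M : ℝ, ∀ f₁ f₂ : Euc d → Euc d, MemCb m α f₁ → MemCb m α f₂ →
      hnorm m α (fun x => g (x + f₁ x) - g (x + f₂ x)) ≤
        M * hnorm (m + 1) β g * (1 + max (hnorm m α f₁) (hnorm m α f₂)) ^ (m + 1) *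
          hnorm m α (f₁ - f₂) := by
  have hα1 : α ≤ 1 := (hαβ.trans_le hβ).le
  obtain ⟨K, hK⟩ := HolderBound.exists_comp_id_add_sub (E := Euc d) hα hαβ.le hα1 m
  refine ⟨K, fun f₁ f₂ h₁ h₂ => ?_⟩
  have b₁ := h₁.holderBound
  have b₂ := h₂.holderBound
  have bsub := HolderBound.sub hα b₁ b₂
  have hsub : MemCb m α (f₁ - f₂) := ⟨bsub.1, bsub.2.trans_lt ENNReal.coe_lt_top⟩
  set R : ℝ≥0 := 1 + max (eHnorm m α f₁).toNNReal (eHnorm m α f₂).toNNReal with hR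
  have B₁ : HolderBound m α R f₁ := b₁.mono ((le_max_left _ _).trans le_add_self)
  have B₂ : HolderBound m α R f₂ := b₂.mono ((le_max_right _ _).trans le_add_self)
  have lip {f : Euc d → Euc d} (h : HolderBound m α R f) : LipschitzWith R f := by
    obtain ⟨k, rfl⟩ := Nat.exists_eq_add_of_le' hm
    exact h.lipschitzWith hα
  have h := (hK G _ R _ g f₁ f₂ (by simp [hR]) hg.holderBound B₁ B₂ (lip B₁) (lip B₂)
    hsub.holderBound).hnorm_le
  refine h.trans_eq ?_
  push_cast [hR]
  simp only [hnorm, ENNReal.toReal]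
  ring
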